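/- arXiv:1602.00099 — 2 statements merged into one kernel-verified Lean document; each statement's English description precedes it below -/
import Mathlib

section
/- Let λ be real with 0<λ<1 and set x=e^{2πiλ} (so x≠1). Then the analytic continuation F(λ,·) of the periodic zeta function satisfies F(λ,0) = x/(1−x), and for every integer n≥1, F(λ,−n) = Σ_{r=1}^{n} Surj(n,r) · x^r/(1−x)^{r+1}. -/
open Complex

/-- `Surj n r` is the number of surjective functions from a set of `n` elements
onto a set of `r` elements (i.e. `r!` times a Stirling number of the second kind). -/
noncomputable def Surj (n r : ℕ) : ℕ :=
  Fintype.card {f : Fin n → Fin r // Function.Surjective f}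

/-- The analytic continuation of the periodic zeta function
`F(λ,u) = Σ_{n=1}^∞ e^{2πinλ} n^{-u}` (Mathlib's `expZeta` at the point `λ`
of the unit additive circle). -/
noncomputable def periodicZeta (lam : ℝ) (u : ℂ) : ℂ :=
  HurwitzZeta.expZeta (lam : UnitAddCircle) u

theorem card_surj_eq {α β : Type} [Fintype α] [Fintype β] [DecidableEq α] [DecidableEq β] :
    Fintype.card {f : α → β // Function.Surjective f} = Surj (Fintype.card α) (Fintype.card β) := by
  classical
  unfold Surj
  let ea := Fintype.equivFin α
  let eb := Fintype.equivFin β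
  refine Fintype.card_congr (Equiv.subtypeEquiv (Equiv.arrowCongr ea eb) ?_)
  intro f
  simp [Equiv.arrowCongr]

theorem surjSplit_ext {α β : Type} [Fintype α] [DecidableEq α]
    (p q : Σ S : {S : Finset α // S ≠ Finset.univ}, {g : {a // a ∈ S.1} → β // Function.Surjective g})
    (h1 : p.1.1 = q.1.1) (h2 : ∀ a h h', p.2.1 ⟨a, h⟩ = q.2.1 ⟨a, h'⟩) : p = q := by
  obtain ⟨⟨S, hS⟩, g, hg⟩ := p
  obtain ⟨⟨S', hS'⟩, g', hg'⟩ := q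
  dsimp only at h1
  subst h1
  congr 2
  funext a
  exact h2 a.1 a.2 a.2

/-- split a surjection onto `Option β` by the set of points not sent to `none`. -/
noncomputable def surjSplit {α β : Type} [Fintype α] [DecidableEq α] [DecidableEq β] :
    {f : α → Option β // Function.Surjective f} ≃
      Σ S : {S : Finset α // S ≠ Finset.univ}, {g : {a // a ∈ S.1} → β // Function.Surjective g} where
  toFun f := ⟨⟨Finset.univ.filter (fun a => (f.1 a).isSome), by
      obtain ⟨a, ha⟩ := f.2 none
      intro h
      have := Finset.mem_univ a
      rw [← h] at this
      simp [ha] at this⟩,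
    ⟨fun a => (f.1 a.1).get (Finset.mem_filter.1 a.2).2, by
      intro b
      obtain ⟨a, ha⟩ := f.2 (some b)
      exact ⟨⟨a, by simp [ha]⟩, by simp [ha]⟩⟩⟩
  invFun p := ⟨fun a => if h : a ∈ p.1.1 then some (p.2.1 ⟨a, h⟩) else none, by
      rintro (_ | b)
      · have := p.1.2
        rw [Ne, Finset.eq_univ_iff_forall] at this
        push Not at this
        obtain ⟨a, ha⟩ := this
        exact ⟨a, by simp [ha]⟩
      · obtain ⟨a, ha⟩ := p.2.2 b
        exact ⟨a.1, by simp [ha]⟩⟩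
  left_inv f := by
    ext1
    funext a
    by_cases h : (f.1 a).isSome
    · simp [h]
    · simp only [Finset.mem_filter, Finset.mem_univ, true_and, h]
      simpa using (Option.not_isSome_iff_eq_none.1 h).symm
  right_inv p := by
    obtain ⟨⟨S, hS⟩, g, hg⟩ := p
    refine surjSplit_ext _ _ ?_ ?_
    · ext a
      by_cases h : a ∈ S <;> simp [h]
    · intro a h h'
      have h2 : a ∈ S := h'
      simp [h2]

theorem Surj_succ (n r : ℕ) :
    Surj n (r+1) = ∑ j ∈ Finset.range n, n.choose j * Surj j r := by
  classical
  have h1 : Surj n (r+1) = Fintype.card {f : Fin n → Option (Fin r) // Function.Surjective f} := by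
    rw [card_surj_eq]; simp
  rw [h1, Fintype.card_congr surjSplit, Fintype.card_sigma]
  have h2 : ∀ S : {S : Finset (Fin n) // S ≠ Finset.univ},
    Fintype.card {g : {a // a ∈ S.1} → Fin r // Function.Surjective g} = Surj S.1.card r := by
    intro S; rw [card_surj_eq]; simp
  simp only [h2]
  have h3 := Finset.sum_powerset_apply_card (fun j => Surj j r) (x := (Finset.univ : Finset (Fin n)))
  rw [Finset.powerset_univ, Finset.card_univ, Fintype.card_fin, Finset.sum_range_succ,
    ← Finset.add_sum_erase _ _ (Finset.mem_univ Finset.univ)] at h3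
  simp only [smul_eq_mul, Nat.choose_self, Finset.card_univ, Fintype.card_fin, one_mul] at h3
  rw [← Finset.sum_subtype (p := fun S : Finset (Fin n) => S ≠ Finset.univ)
    (Finset.univ.erase Finset.univ) (by simp) (fun S => Surj S.card r)]
  omega

theorem Surj_zero_zero : Surj 0 0 = 1 := by
  simp [Surj, Function.Surjective]

theorem Surj_zero_right {n : ℕ} (hn : n ≠ 0) : Surj n 0 = 0 := by
  obtain ⟨m, rfl⟩ := Nat.exists_eq_succ_of_ne_zero hn
  simp [Surj]

theorem Surj_eq_zero {n r : ℕ} (h : n < r) : Surj n r = 0 := by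
  unfold Surj
  rw [Fintype.card_eq_zero_iff]
  refine ⟨fun f => ?_⟩
  have := Fintype.card_le_of_surjective _ f.2
  simp at this; omega

/-- auxiliary sum -/
noncomputable def BB (x : ℂ) (n : ℕ) : ℂ := ∑ r ∈ Finset.range (n+1), (Surj n r : ℂ) * x ^ r / (1 - x) ^ (r + 1)

theorem BB_eq (x : ℂ) {n M : ℕ} (h : n < M) :
    BB x n = ∑ r ∈ Finset.range M, (Surj n r : ℂ) * x ^ r / (1 - x) ^ (r + 1) := by
  unfold BB
  apply Finset.sum_subset
  · intro a; simp; omega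
  · intro a _ ha
    have : n < a := by simpa using ha
    simp [Surj_eq_zero this]

theorem BB_rec (x : ℂ) (hx : 1 - x ≠ 0) {n : ℕ} (hn : n ≠ 0) :
    (1 - x) * BB x n = x * ∑ j ∈ Finset.range n, (n.choose j : ℂ) * BB x j := by
  rw [BB, Finset.sum_range_succ', Surj_zero_right hn]
  have : ∀ j ∈ Finset.range n, (n.choose j : ℂ) * BB x j = 
     ∑ r ∈ Finset.range n, (n.choose j : ℂ) * ((Surj j r : ℂ) * x ^ r / (1 - x) ^ (r + 1)) := by
    intro j hj
    rw [BB_eq x (Finset.mem_range.1 hj), Finset.mul_sum]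
  rw [Finset.sum_congr rfl this, Finset.sum_comm]
  simp only [Surj_succ]
  simp only [Nat.cast_zero, zero_mul, zero_div, add_zero, Finset.mul_sum]
  refine Finset.sum_congr rfl fun r _ => ?_
  push_cast
  simp only [Finset.sum_mul, Finset.sum_div, Finset.mul_sum]
  refine Finset.sum_congr rfl fun r _ => ?_
  field_simp
  ring

/-- The recursion determines the values. -/
theorem rec_solve (x : ℂ) (hx : 1 - x ≠ 0) (F : ℕ → ℂ)
    (hF : ∀ n, F n = x + x * ∑ j ∈ Finset.range (n+1), (n.choose j : ℂ) * F j) :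
    F 0 = x / (1 - x) ∧ ∀ n : ℕ, 1 ≤ n → F n =
        ∑ r ∈ Finset.Icc 1 n, (Surj n r : ℂ) * x ^ r / (1 - x) ^ (r + 1) := by
  have h0 : F 0 = x / (1 - x) := by
    have := hF 0
    simp at this
    field_simp
    linear_combination this
  have hB0 : BB x 0 = 1 + F 0 := by
    rw [h0]; simp [BB, Surj_zero_zero]; field_simp; ring
  have key : ∀ n, n ≠ 0 → F n = BB x n := by
    intro n
    induction n using Nat.strong_induction_on with
    | _ n ih =>
      intro hn
      apply mul_left_cancel₀ hx
      rw [BB_rec x hx hn]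
      have := hF n
      obtain ⟨m, rfl⟩ := Nat.exists_eq_succ_of_ne_zero hn
      rw [Finset.sum_range_succ, Finset.sum_range_succ'] at this
      rw [Finset.sum_range_succ', hB0]
      have e : ∑ k ∈ Finset.range m, ((m+1).choose (k+1) : ℂ) * F (k+1) = 
        ∑ k ∈ Finset.range m, ((m+1).choose (k+1) : ℂ) * BB x (k+1) := by
        refine Finset.sum_congr rfl fun k hk => ?_
        rw [ih (k+1) (by simp at hk ⊢; omega) (by simp)]
      simp only [Nat.succ_eq_add_one] at *
      rw [e] at this
      simp at this ⊢
      linear_combination this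
  refine ⟨h0, fun n hn => ?_⟩
  rw [key n (by omega), BB, Finset.sum_range_succ', Surj_zero_right (by omega)]
  rw [← Finset.Ico_succ_right_eq_Icc, Finset.sum_Ico_eq_sum_range]
  simp [add_comm]

/-- binomial coefficients `binom(-s,k)`. -/
noncomputable def cc : ℕ → ℂ → ℂ
  | 0, _ => 1
  | (k+1), s => -s / (k+1) * cc k (s+1)

theorem cc_diff (k : ℕ) : Differentiable ℂ (cc k) := by
  induction k with
  | zero => exact differentiable_const _
  | succ k ih =>
    have : cc (k+1) = fun s => -s / (k+1) * cc k (s+1) := by ext; rfl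
    rw [this]
    have h : Differentiable ℂ (fun s => cc k (s+1)) := ih.comp (differentiable_id.add_const 1)
    fun_prop

theorem cc_neg (k : ℕ) : ∀ n : ℕ, cc k (-(n:ℂ)) = n.choose k := by
  induction k with
  | zero => simp [cc]
  | succ k ih =>
    rintro (_ | n)
    · simp [cc]
    · rw [cc, show -((n+1:ℕ):ℂ) + 1 = -(n:ℂ) by push_cast; ring, ih]
      have := Nat.add_one_mul_choose_eq n k
      have h : ((n:ℂ)+1) * n.choose k = (n+1).choose (k+1) * (k+1) := by exact_mod_cast this
      have : (k:ℂ) + 1 ≠ 0 := by exact_mod_cast Nat.succ_ne_zero k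
      field_simp
      push_cast
      linear_combination h

/-- Taylor remainder -/
noncomputable def RR (N : ℕ) (s : ℂ) (t : ℝ) : ℂ :=
  ((1 + t : ℝ) : ℂ) ^ (-s) - ∑ k ∈ Finset.range N, cc k s * (t:ℂ) ^ k

theorem RR_deriv (N : ℕ) (s : ℂ) {t : ℝ} (ht : 0 ≤ t) :
    HasDerivAt (RR (N+1) s) (-s * RR N (s+1) t) t := by
  have h1 : HasDerivAt (fun t : ℝ => ((1 + t : ℝ) : ℂ) ^ (-s)) (-s * ((1 + t : ℝ) : ℂ) ^ (-s-1)) t := by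
    have h : HasDerivAt (fun z : ℂ => 1 + z) 1 (t:ℂ) := (hasDerivAt_id _).const_add 1
    have := (h.cpow_const (c := -s) (Or.inl (by simp; linarith))).comp_ofReal
    simpa using this
  have h2 : HasDerivAt (fun t : ℝ => ∑ k ∈ Finset.range (N+1), cc k s * (t:ℂ) ^ k)
     (-s * ∑ k ∈ Finset.range N, cc k (s+1) * (t:ℂ) ^ k) t := by
    have h : ∀ k ∈ Finset.range (N+1), HasDerivAt (fun t : ℝ => cc k s * (t:ℂ)^k) (cc k s * (k * (t:ℂ)^(k-1))) t := by
      intro k _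
      have := ((hasDerivAt_pow k (t:ℂ)).comp_ofReal).const_mul (cc k s)
      simpa using this
    have := HasDerivAt.fun_sum h
    convert! this using 1
    rw [Finset.sum_range_succ', Finset.mul_sum]
    simp only [Nat.cast_zero, zero_mul, mul_zero, add_zero]
    refine Finset.sum_congr rfl fun k _ => ?_
    have : (k:ℂ) + 1 ≠ 0 := by exact_mod_cast Nat.succ_ne_zero k
    simp [cc]
    field_simp
  have := h1.sub h2
  convert! this using 1
  unfold RR
  rw [show -(s+1) = -s-1 by ring]
  ring

theorem RR_bound (N : ℕ) : ∀ (s : ℂ), 0 ≤ s.re + N → ∀ t : ℝ, 0 ≤ t →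
    ‖RR N s t‖ ≤ (∏ j ∈ Finset.range N, ‖s + j‖) * t ^ N := by
  induction N with
  | zero =>
    intro s hs t ht
    simp only [RR, Finset.range_zero, Finset.sum_empty, sub_zero, Finset.prod_empty, pow_zero, mul_one]
    rw [norm_cpow_eq_rpow_re_of_pos (by linarith)]
    apply Real.rpow_le_one_of_one_le_of_nonpos (by linarith)
    simpa using hs
  | succ N ih =>
    intro s hs t ht
    have h0 : RR (N+1) s 0 = 0 := by
      simp [RR, Finset.sum_range_succ', cc]
    have := norm_image_sub_le_of_norm_deriv_le_segment' (f := RR (N+1) s) (a := 0) (b := t)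
      (f' := fun t => -s * RR N (s+1) t) (C := (∏ j ∈ Finset.range (N+1), ‖s + j‖) * t ^ N)
      (fun u hu => (RR_deriv N s hu.1).hasDerivWithinAt) ?_ t ⟨ht, le_rfl⟩
    · rw [h0, sub_zero, sub_zero] at this
      rw [pow_succ]; linarith
    · intro u hu
      rw [norm_mul, norm_neg, Finset.prod_range_succ']
      have h := ih (s+1) (by simp at hs ⊢; linarith) u hu.1
      have e : ∏ j ∈ Finset.range N, ‖s + 1 + j‖ = ∏ j ∈ Finset.range N, ‖s + (j+1:ℕ)‖ :=
        Finset.prod_congr rfl fun j _ => by push_cast; congr 1; ring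
      rw [e] at h
      have hp : 0 ≤ ∏ j ∈ Finset.range N, ‖s + (j+1:ℕ)‖ := Finset.prod_nonneg fun _ _ => norm_nonneg _
      have h' : u ^ N ≤ t ^ N := pow_le_pow_left₀ hu.1 hu.2.le N
      calc ‖s‖ * ‖RR N (s+1) u‖ ≤ ‖s‖ * ((∏ j ∈ Finset.range N, ‖s + (j+1:ℕ)‖) * t ^ N) := by
            gcongr; exact h.trans (by gcongr)
        _ = _ := by simp; ring

theorem RR_zero {N n : ℕ} (h : n < N) {t : ℝ} (ht : 0 ≤ t) : RR N (-(n:ℂ)) t = 0 := by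
  have := RR_bound N (-(n:ℂ)) (by simp; exact_mod_cast h.le) t ht
  rw [Finset.prod_eq_zero (Finset.mem_range.2 h) (by simp), zero_mul] at this
  exact norm_le_zero_iff.1 this

/-- general term -/
noncomputable def TT (x : ℂ) (N : ℕ) (m : ℕ) (s : ℂ) : ℂ :=
  x ^ (m+1) * (((m+1 : ℕ):ℂ) ^ (-s) * RR N s (1 / ((m+1:ℕ):ℝ)))

theorem TT_expand (x : ℂ) (N m : ℕ) (s : ℂ) :
    TT x N m s = x ^ (m+1) * ((m+2:ℕ):ℂ) ^ (-s) -
      ∑ k ∈ Finset.range N, cc k s * (x ^ (m+1) * ((m+1:ℕ):ℂ) ^ (-(s+k))) := by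
  have hm : ((m+1:ℕ):ℂ) ≠ 0 := by exact_mod_cast Nat.succ_ne_zero m
  unfold TT RR
  rw [mul_sub, mul_sub]
  congr 1
  · congr 1
    rw [← ofReal_natCast, ← mul_cpow_ofReal_nonneg (by positivity) (by positivity), ← ofReal_mul]
    congr 1
    have hm : ((m+1:ℕ):ℝ) ≠ 0 := by exact_mod_cast Nat.succ_ne_zero m
    rw [mul_add, mul_one_div_cancel hm]
    push_cast; ring
  · rw [Finset.mul_sum, Finset.mul_sum]
    refine Finset.sum_congr rfl fun k _ => ?_
    rw [show -(s+k) = -s - k by ring, cpow_sub _ _ hm, cpow_natCast]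
    push_cast at hm ⊢
    rw [one_div, inv_pow]
    field_simp

theorem TT_diff (x : ℂ) (N m : ℕ) : Differentiable ℂ (TT x N m) := by
  have : TT x N m = _ := funext (TT_expand x N m)
  rw [this]
  have h1 : ∀ k, Differentiable ℂ (cc k) := cc_diff
  have h2 : ∀ j : ℕ, Differentiable ℂ (fun s : ℂ => ((j+1:ℕ):ℂ) ^ (-s)) := fun j s =>
    (differentiableAt_id.neg).const_cpow (Or.inl (by exact_mod_cast Nat.succ_ne_zero j))
  have h3 : ∀ k : ℕ, Differentiable ℂ (fun s : ℂ => ((m+1:ℕ):ℂ) ^ (-(s+k))) := fun k s =>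
    ((differentiableAt_id.add_const _).neg).const_cpow (Or.inl (by exact_mod_cast Nat.succ_ne_zero m))
  have h4 := h2 (m+1)
  refine (h4.const_mul _).sub ?_
  refine Differentiable.fun_sum fun k _ => (h1 k).mul ((h3 k).const_mul _)

theorem TT_bound {x : ℂ} (hx : ‖x‖ = 1) (N m : ℕ) {s : ℂ} {B : ℝ} (hs : -(N:ℝ) + 3/2 < s.re)
    (hB : ‖s‖ < B) : ‖TT x N m s‖ ≤ (∏ j ∈ Finset.range N, (B + j)) * (((m+1:ℕ):ℝ) ^ (-(3/2) : ℝ)) := by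
  have hm : (0:ℝ) < ((m+1:ℕ):ℝ) := by positivity
  have hm1 : (1:ℝ) ≤ ((m+1:ℕ):ℝ) := by exact_mod_cast Nat.succ_le_succ (Nat.zero_le m)
  have h1 := RR_bound N s (by linarith) (1 / ((m+1:ℕ):ℝ)) (by positivity)
  rw [TT, norm_mul, norm_pow, hx, one_pow, one_mul, norm_mul, ← ofReal_natCast,
    norm_cpow_eq_rpow_re_of_pos hm]
  have h2 : ∏ j ∈ Finset.range N, ‖s + j‖ ≤ ∏ j ∈ Finset.range N, (B + j) := by
    refine Finset.prod_le_prod (fun _ _ => norm_nonneg _) fun j _ => ?_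
    refine (norm_add_le _ _).trans ?_
    simp; exact hB.le
  have hB0 : 0 ≤ ∏ j ∈ Finset.range N, (B + j) := (Finset.prod_nonneg fun _ _ => norm_nonneg _).trans h2
  calc _ ≤ ((m+1:ℕ):ℝ) ^ (-s).re * ((∏ j ∈ Finset.range N, (B + j)) * (1 / ((m+1:ℕ):ℝ)) ^ N) := by
        gcongr; exact h1.trans (by gcongr)
    _ = (∏ j ∈ Finset.range N, (B + j)) * ((m+1:ℕ):ℝ) ^ (-s.re - N) := by
        rw [Real.rpow_sub hm, Real.rpow_natCast, neg_re, one_div, inv_pow]; field_simp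
    _ ≤ _ := by
        gcongr ?_ * ?_
        exact Real.rpow_le_rpow_of_exponent_le hm1 (by linarith)

open HurwitzZeta in
theorem TT_hasSum (lam : ℝ) {x : ℂ} (hx : x = Complex.exp (2 * Real.pi * I * lam)) (N : ℕ) {s : ℂ}
    (hs : 1 < s.re) : x * ∑' m, TT x N m s = expZeta lam s - x -
      x * ∑ k ∈ Finset.range N, cc k s * expZeta lam (s + k) := by
  have hx0 : x ≠ 0 := by rw [hx]; exact exp_ne_zero _
  have h : ∀ u : ℂ, 1 < u.re → HasSum (fun m : ℕ => x ^ (m+1) * ((m+1:ℕ):ℂ) ^ (-u)) (expZeta lam u) := by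
    intro u hu
    have := hasSum_expZeta_of_one_lt_re lam hu
    have hu0 : u ≠ 0 := by rintro rfl; simp at hu; linarith
    rw [← hasSum_nat_add_iff' 1] at this
    simp [hu0] at this
    convert! this using 2 with m
    rw [hx, cpow_neg, ← Complex.exp_nat_mul, div_eq_mul_inv]
    push_cast
    congr 2
    ring
  have h1 : HasSum (fun m : ℕ => x ^ (m+1) * ((m+2:ℕ):ℂ) ^ (-s)) ((expZeta lam s - x) / x) := by
    have := h s hs
    rw [← hasSum_nat_add_iff' 1] at this
    have := this.div_const x
    simp at this
    convert! this using 2 with m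
    rw [pow_succ x (m+1), show m + 2 = m + 1 + 1 from rfl]
    push_cast
    field_simp
  have h2 : HasSum (fun m : ℕ => ∑ k ∈ Finset.range N, cc k s * (x ^ (m+1) * ((m+1:ℕ):ℂ) ^ (-(s+k))))
      (∑ k ∈ Finset.range N, cc k s * expZeta lam (s + k)) := by
    refine hasSum_sum fun k _ => (h (s+k) ?_).mul_left _
    simp; linarith [(Nat.cast_nonneg k : (0:ℝ) ≤ k)]
  have h3 := h1.sub h2
  have h4 : (fun m => TT x N m s) = _ := funext fun m => TT_expand x N m s
  rw [h4, h3.tsum_eq, mul_sub, mul_div_cancel₀ _ hx0]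

open HurwitzZeta in
theorem F_rec (lam : ℝ) (hlam0 : 0 < lam) (hlam1 : lam < 1)
    (x : ℂ) (hx : x = Complex.exp (2 * Real.pi * I * lam)) (n : ℕ) :
    expZeta lam (-(n:ℂ)) = x + x * ∑ j ∈ Finset.range (n+1), (n.choose j : ℂ) * expZeta lam (-(j:ℂ)) := by
  have hx1 : ‖x‖ = 1 := by
    rw [hx, show (2 * Real.pi * I * lam : ℂ) = ((2 * Real.pi * lam : ℝ):ℂ) * I by push_cast; ring]
    exact norm_exp_ofReal_mul_I _
  have ha : (lam : UnitAddCircle) ≠ 0 := by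
    intro h
    rw [AddCircle.coe_eq_zero_iff] at h
    obtain ⟨k, hk⟩ := h
    simp at hk
    rw [← hk] at hlam0 hlam1
    norm_cast at hlam0 hlam1
    omega
  have hE := differentiable_expZeta_of_ne_zero ha
  set N := n + 2 with hN
  set B : ℝ := n + 3 with hB
  let U : Set ℂ := {s | -(N:ℝ) + 3/2 < s.re} ∩ Metric.ball 0 B
  have hUo : IsOpen U := (isOpen_lt continuous_const continuous_re).inter Metric.isOpen_ball
  have hUc : IsPreconnected U :=
    ((convex_halfSpace_re_gt _).inter (convex_ball _ _)).isPreconnected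
  have hf : DifferentiableOn ℂ (fun s => x * ∑' m, TT x N m s) U := by
    refine DifferentiableOn.const_mul ?_ x
    refine differentiableOn_tsum_of_summable_norm
      (u := fun m : ℕ => (∏ j ∈ Finset.range N, (B + j)) * (((m+1:ℕ):ℝ) ^ (-(3/2) : ℝ))) ?_ 
      (fun m => (TT_diff x N m).differentiableOn) hUo ?_
    · refine Summable.mul_left _ ?_
      rw [summable_nat_add_iff (f := fun m : ℕ => (m:ℝ) ^ (-(3/2):ℝ)) 1]
      rw [Real.summable_nat_rpow]; norm_num
    · intro m s hs
      exact TT_bound hx1 N m hs.1 (by simpa using hs.2)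
  have hg : Differentiable ℂ (fun s => expZeta lam s - x -
      x * ∑ k ∈ Finset.range N, cc k s * expZeta lam (s + k)) := by
    refine (hE.sub_const x).sub (Differentiable.const_mul ?_ x)
    exact Differentiable.fun_sum fun k _ => (cc_diff k).mul (hE.comp (differentiable_id.add_const _))
  have h2 : (2:ℂ) ∈ U := by
    refine ⟨?_, ?_⟩
    · simp [hN]; linarith [(Nat.cast_nonneg n : (0:ℝ) ≤ n)]
    · simp [hB]; linarith [(Nat.cast_nonneg n : (0:ℝ) ≤ n)]
  have hnU : -(n:ℂ) ∈ U := by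
    refine ⟨?_, ?_⟩
    · simp [hN]; linarith
    · simp [hB]
  have key := (hf.analyticOnNhd hUo).eqOn_of_preconnected_of_eventuallyEq
    (hg.differentiableOn.analyticOnNhd hUo) hUc h2 (by
      filter_upwards [(isOpen_lt continuous_const continuous_re).mem_nhds
        (show (2:ℂ) ∈ {s : ℂ | 1 < s.re} by simp)] with s hs
      exact TT_hasSum lam hx N hs) hnU
  have hz : ∀ m, TT x N m (-(n:ℂ)) = 0 := by
    intro m
    rw [TT, RR_zero (by omega) (by positivity)]; simp
  simp only [hz, tsum_zero, mul_zero, cc_neg] at key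
  rw [hN, Finset.sum_range_succ, Nat.choose_succ_self] at key
  have e : ∑ k ∈ Finset.range (n+1), (n.choose k : ℂ) * expZeta lam (-(n:ℂ) + k) =
      ∑ j ∈ Finset.range (n+1), (n.choose j : ℂ) * expZeta lam (-(j:ℂ)) := by
    rw [← Finset.sum_range_reflect]
    refine Finset.sum_congr rfl fun j hj => ?_
    have hj' : j ≤ n := by simp at hj; omega
    rw [show n + 1 - 1 - j = n - j by omega, Nat.choose_symm hj', Nat.cast_sub hj']
    congr 2; ring
  rw [e] at key
  simp at key
  linear_combination -key

theorem one_sub_ne (lam : ℝ) (hlam0 : 0 < lam) (hlam1 : lam < 1)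
    (x : ℂ) (hx : x = Complex.exp (2 * Real.pi * I * lam)) : 1 - x ≠ 0 := by
  intro h
  have : Complex.exp (2 * Real.pi * I * lam) = 1 := by rw [← hx]; linear_combination -h
  rw [Complex.exp_eq_one_iff] at this
  obtain ⟨k, hk⟩ := this
  have hp : (2 * Real.pi * I : ℂ) ≠ 0 := two_pi_I_ne_zero
  rw [mul_comm (k:ℂ)] at hk
  have := mul_left_cancel₀ hp hk
  have : lam = k := by exact_mod_cast this
  rw [this] at hlam0 hlam1
  norm_cast at hlam0 hlam1
  omega

/-- Values of the analytically continued periodic zeta function at nonpositive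
integers: for `0 < λ < 1` and `x = e^{2πiλ}`, `F(λ,0) = x/(1-x)` and, for `n ≥ 1`,
`F(λ,-n) = Σ_{r=1}^{n} Surj(n,r) x^r/(1-x)^{r+1}`. -/
theorem periodicZeta_nonpos_int_values (lam : ℝ) (hlam0 : 0 < lam) (hlam1 : lam < 1)
    (x : ℂ) (hx : x = Complex.exp (2 * Real.pi * I * lam)) :
    periodicZeta lam 0 = x / (1 - x) ∧
    ∀ n : ℕ, 1 ≤ n →
      periodicZeta lam (-(n : ℂ)) =
        ∑ r ∈ Finset.Icc 1 n, (Surj n r : ℂ) * x ^ r / (1 - x) ^ (r + 1) := by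
  have h := rec_solve x (one_sub_ne lam hlam0 hlam1 x hx)
    (fun n => periodicZeta lam (-(n : ℂ))) (F_rec lam hlam0 hlam1 x hx)
  simpa using h
end

section
/- (Contour shift over the poles of 1/sin πu.) Let s∈ℂ with Re s>0, let c,c' be real with 0<c<1 and 0<c'<1, let N≥1 be an integer, and let z∈ℂ with z∉(−∞,0]. Then (i/(4π)) ∫_{t∈ℝ} [Γ(c+it+s)/sin(π(c+it))] · z^{−(c+it)−s} dt = (1/(2πi)) Σ_{r=1}^{N−1} (−1)^r Γ(r+s) z^{−r−s} + ((−1)^N i/(4π)) ∫_{t∈ℝ} [Γ(−c'+it+N+s)/sin(π(−c'+it))] · z^{−(−c'+it)−N−s} dt, where both integrals converge absolutely. -/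
open Complex MeasureTheory

lemma mb_tendsto_inv (p : ℝ) (hp : p ≠ 0) (L : ℝ)
    (hL : Filter.Tendsto (fun T : ℝ => Real.arctan (T / p)) Filter.atTop (nhds L)) :
    Filter.Tendsto (fun T : ℝ => ∫ t in (-T)..T, ((p : ℂ) + t * I)⁻¹) Filter.atTop
      (nhds ((2 * L : ℝ) : ℂ)) := by
  have key : ∀ T : ℝ, ∫ t in (-T)..T, ((p : ℂ) + t * I)⁻¹ = ((2 * Real.arctan (T / p) : ℝ) : ℂ) := by
    intro T
    have hne : ∀ t : ℝ, (p : ℂ) + t * I ≠ 0 := by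
      intro t h
      apply hp
      simpa using congrArg Complex.re h
    have hd : ∀ t ∈ Set.uIcc (-T) T, HasDerivAt
        (fun t : ℝ => ((Real.arctan (t / p) : ℝ) : ℂ)
          - ((1 / 2 * Real.log (p ^ 2 + t ^ 2) : ℝ) : ℂ) * I) (((p : ℂ) + t * I)⁻¹) t := by
      intro t _
      have hpos : 0 < p ^ 2 + t ^ 2 := by positivity
      have h1 : HasDerivAt (fun t : ℝ => Real.arctan (t / p)) (p / (p ^ 2 + t ^ 2)) t := by
        have := ((hasDerivAt_id t).div_const p).arctan
        refine this.congr_deriv ?_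
        simp only [id]
        field_simp
      have h2 : HasDerivAt (fun t : ℝ => 1 / 2 * Real.log (p ^ 2 + t ^ 2))
          (t / (p ^ 2 + t ^ 2)) t := by
        have := ((((hasDerivAt_id t).pow 2).const_add (p ^ 2)).log hpos.ne').const_mul (1 / 2 : ℝ)
        refine this.congr_deriv ?_
        simp only [id, Pi.pow_apply]
        field_simp
        norm_num
      refine (h1.ofReal_comp.sub (h2.ofReal_comp.mul_const I)).congr_deriv ?_
      have hpc : ((p : ℂ) ^ 2 + (t : ℂ) ^ 2) ≠ 0 := by exact_mod_cast hpos.ne'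
      push_cast
      refine eq_inv_of_mul_eq_one_left ?_
      field_simp
      ring_nf
      simp
    rw [intervalIntegral.integral_eq_sub_of_hasDerivAt hd]
    · rw [neg_div, Real.arctan_neg]
      push_cast
      ring_nf
    · apply Continuous.intervalIntegrable
      exact Continuous.inv₀ (by fun_prop) hne
  simp_rw [key]
  exact (Complex.continuous_ofReal.tendsto _).comp (hL.const_mul 2)

lemma mb_shift (F G : ℂ → ℂ) (a b n : ℝ) (A : ℂ) (han : a < n) (hnb : n < b) (ε : ℝ → ℝ)
    (hε : Filter.Tendsto ε Filter.atTop (nhds 0))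
    (hG : DifferentiableOn ℂ G {u | a ≤ u.re ∧ u.re ≤ b})
    (hFG : ∀ u : ℂ, a ≤ u.re → u.re ≤ b → u ≠ n → F u = G u + A / (u - n))
    (hF : ∀ x : ℝ, a ≤ x → x ≤ b → ∀ t : ℝ, 1 ≤ |t| → ‖F (x + t * I)‖ ≤ ε |t|)
    (ha : Integrable (fun t : ℝ => F (a + t * I))) (hb : Integrable (fun t : ℝ => F (b + t * I))) :
    (∫ t : ℝ, F (b + t * I)) - (∫ t : ℝ, F (a + t * I)) = 2 * Real.pi * A := by
  have hab : a < b := han.trans hnb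
  have hGc : ∀ x : ℝ, a ≤ x → x ≤ b → Continuous (fun t : ℝ => G (x + t * I)) := by
    intro x h1 h2
    exact hG.continuousOn.comp_continuous (by fun_prop) (by intro t; simp [h1, h2])
  -- vertical sides
  have vert : ∀ x : ℝ, a ≤ x → x ≤ b → x ≠ n → Integrable (fun t : ℝ => F (x + t * I)) → ∀ L : ℝ,
      Filter.Tendsto (fun T : ℝ => Real.arctan (T / (x - n))) Filter.atTop (nhds L) →
      Filter.Tendsto (fun T : ℝ => ∫ t in (-T)..T, G (x + t * I)) Filter.atTop
        (nhds ((∫ t : ℝ, F (x + t * I)) - A * ((2 * L : ℝ) : ℂ))) := by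
    intro x h1 h2 hxn hi L hL
    have hxn' : x - n ≠ 0 := sub_ne_zero.mpr hxn
    have e : ∀ T : ℝ, ∫ t in (-T)..T, G (x + t * I) =
        (∫ t in (-T)..T, F (x + t * I)) - A * ∫ t in (-T)..T, (((x - n : ℝ) : ℂ) + t * I)⁻¹ := by
      intro T
      rw [← intervalIntegral.integral_const_mul, ← intervalIntegral.integral_sub]
      · apply intervalIntegral.integral_congr
        intro t _
        have hne : (x : ℂ) + t * I ≠ n := by
          intro h
          apply hxn
          simpa using congrArg Complex.re h
        simp only
        rw [hFG _ (by simpa using h1) (by simpa using h2) hne]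
        have : (x : ℂ) + t * I - n = ((x - n : ℝ) : ℂ) + t * I := by push_cast; ring
        rw [this]
        ring
      · exact hi.intervalIntegrable
      · apply Continuous.intervalIntegrable
        apply continuous_const.mul
        apply Continuous.inv₀ (by fun_prop)
        intro t h
        apply hxn'
        simpa using congrArg Complex.re h
    simp_rw [e]
    exact (intervalIntegral_tendsto_integral hi Filter.tendsto_neg_atTop_atBot
      Filter.tendsto_id).sub ((mb_tendsto_inv _ hxn' L hL).const_mul A)
  have hB := vert b hab.le le_rfl hnb.ne' hb (Real.pi / 2)
    ((tendsto_nhds_of_tendsto_nhdsWithin Real.tendsto_arctan_atTop).comp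
      (Filter.tendsto_id.atTop_div_const (sub_pos.mpr hnb)))
  have hA := vert a le_rfl hab.le han.ne ha (-(Real.pi / 2))
    ((tendsto_nhds_of_tendsto_nhdsWithin Real.tendsto_arctan_atBot).comp
      (Filter.tendsto_id.atTop_div_const_of_neg (sub_neg.mpr han)))
  -- horizontal sides
  have hor : ∀ σ : ℝ, |σ| = 1 → Filter.Tendsto
      (fun T : ℝ => ∫ x in a..b, G (x + ((σ * T : ℝ) : ℂ) * I)) Filter.atTop (nhds 0) := by
    intro σ hσ
    have hlim : Filter.Tendsto (fun T : ℝ => (ε T + ‖A‖ / T) * |b - a|) Filter.atTop (nhds 0) := by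
      have := (hε.add (Filter.tendsto_id.const_div_atTop ‖A‖)).mul_const |b - a|
      simpa using this
    apply squeeze_zero_norm' _ hlim
    filter_upwards [Filter.eventually_ge_atTop (1 : ℝ)] with T hT
    apply intervalIntegral.norm_integral_le_of_norm_le_const
    intro x hx
    rw [Set.uIoc_of_le hab.le] at hx
    have hT0 : 0 < T := by linarith
    have habs : |σ * T| = T := by rw [abs_mul, hσ, one_mul, abs_of_pos hT0]
    have him : T ≤ ‖(x : ℂ) + ((σ * T : ℝ) : ℂ) * I - n‖ := by
      have := Complex.abs_im_le_norm ((x : ℂ) + ((σ * T : ℝ) : ℂ) * I - n)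
      have h2 : ((x : ℂ) + ((σ * T : ℝ) : ℂ) * I - n).im = σ * T := by simp
      rwa [h2, habs] at this
    have hne : (x : ℂ) + ((σ * T : ℝ) : ℂ) * I ≠ n := by
      intro h
      rw [h, sub_self, norm_zero] at him
      linarith
    have h1 := hFG _ (by simpa using hx.1.le) (by simpa using hx.2) hne
    rw [← sub_eq_iff_eq_add] at h1
    rw [← h1]
    refine (norm_sub_le _ _).trans (add_le_add ?_ ?_)
    · have := hF x hx.1.le hx.2 (σ * T) (by rw [habs]; exact hT)
      rwa [habs] at this
    · rw [norm_div]
      gcongr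
  have hP := hor 1 (by simp)
  have hM := hor (-1) (by simp)
  have hall := ((hM.sub hP).add (hB.const_mul I)).sub (hA.const_mul I)
  have hz := tendsto_nhds_unique (hall.congr' (f₂ := fun _ => 0) ?_) tendsto_const_nhds
  · have hI : I * ((∫ t : ℝ, F (b + t * I)) - (∫ t : ℝ, F (a + t * I)) - 2 * Real.pi * A) = 0 := by
      rw [← hz]
      push_cast
      ring
    have := (mul_eq_zero.mp hI).resolve_left I_ne_zero
    exact sub_eq_zero.mp this
  · filter_upwards [Filter.eventually_ge_atTop (1 : ℝ)] with T hT
    have := integral_boundary_rect_eq_zero_of_differentiableOn G ⟨a, -T⟩ ⟨b, T⟩ (hG.mono ?_)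
    · simpa using this
    · intro u hu
      simp only [Complex.mem_reProdIm, Set.uIcc_of_le hab.le] at hu
      exact hu.1


lemma mb_norm_Gamma_le (w : ℂ) (hw : 0 < w.re) : ‖Complex.Gamma w‖ ≤ Real.Gamma w.re := by
  rw [Complex.Gamma_eq_integral hw, Complex.GammaIntegral, Real.Gamma_eq_integral hw]
  refine (norm_integral_le_integral_norm _).trans (le_of_eq ?_)
  apply setIntegral_congr_fun measurableSet_Ioi
  intro x hx
  simp only
  rw [norm_mul, Complex.norm_cpow_eq_rpow_re_of_pos hx, Complex.norm_real, Real.norm_eq_abs,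
    abs_of_pos (Real.exp_pos _)]
  simp

lemma mb_sin_lower (x t : ℝ) (ht : 1 ≤ |t|) :
    Real.exp (Real.pi * |t|) / 4 ≤ ‖Complex.sin (Real.pi * ((x : ℂ) + t * I))‖ := by
  have h1 : ‖Complex.sin (Real.pi * ((x : ℂ) + t * I))‖ ^ 2 =
      Real.sin (Real.pi * x) ^ 2 + Real.sinh (Real.pi * t) ^ 2 := by
    have e : (Real.pi : ℂ) * ((x : ℂ) + t * I)
        = ((Real.pi * x : ℝ) : ℂ) + ((Real.pi * t : ℝ) : ℂ) * I := by push_cast; ring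
    rw [e, Complex.sin_add_mul_I, ← Complex.ofReal_sin, ← Complex.ofReal_cos, ← Complex.ofReal_sinh,
      ← Complex.ofReal_cosh, ← Complex.ofReal_mul, ← Complex.ofReal_mul, ← Complex.normSq_eq_norm_sq,
      Complex.normSq_add_mul_I, mul_pow, mul_pow, Real.cos_sq', Real.cosh_sq]
    ring
  have h2 : Real.exp (Real.pi * |t|) / 4 ≤ Real.sinh (Real.pi * |t|) := by
    rw [Real.sinh_eq]
    have hp : 1 ≤ Real.pi * |t| := by nlinarith [Real.pi_gt_three]
    have h3 : Real.exp (-(Real.pi * |t|)) ≤ 1 := Real.exp_le_one_iff.mpr (by linarith)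
    have h4 := Real.add_one_le_exp (Real.pi * |t|)
    linarith
  have h5 : Real.sinh (Real.pi * |t|) ^ 2 = Real.sinh (Real.pi * t) ^ 2 := by
    rcases abs_choice t with h | h <;> rw [h]
    rw [mul_neg, Real.sinh_neg, neg_sq]
  apply le_of_sq_le_sq _ (norm_nonneg _)
  rw [h1, ← h5]
  have := pow_le_pow_left₀ (by positivity) h2 2
  nlinarith [sq_nonneg (Real.sin (Real.pi * x))]

lemma mb_arg_lt (z : ℂ) (hz : z ∈ Complex.slitPlane) : |z.arg| < Real.pi := by
  have := (Complex.mem_slitPlane_iff_arg.mp hz).1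
  rw [abs_lt]
  exact ⟨Complex.neg_pi_lt_arg z, lt_of_le_of_ne (Complex.arg_le_pi z) this⟩

noncomputable def mbF (s z u : ℂ) : ℂ :=
  Complex.Gamma (u + s) / Complex.sin (Real.pi * u) * z ^ (-u - s)

lemma mb_decay (s : ℂ) (hs : 0 < s.re) (z : ℂ) (hz : z ∈ Complex.slitPlane) (a b : ℝ)
    (ha : 0 < a) : ∃ C : ℝ, ∀ x : ℝ, a ≤ x → x ≤ b → ∀ t : ℝ, 1 ≤ |t| →
      ‖mbF s z (x + t * I)‖ ≤ C * Real.exp (-(Real.pi - |z.arg|) * |t|) := by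
  have hz0 : z ≠ 0 := Complex.slitPlane_ne_zero hz
  have hcont : ContinuousOn (fun x : ℝ => Real.Gamma (x + s.re) * ‖z‖ ^ (-x - s.re))
      (Set.Icc a b) := by
    intro x hx
    apply ContinuousAt.continuousWithinAt
    apply ContinuousAt.mul
    · apply ContinuousAt.comp (f := fun x : ℝ => x + s.re) (g := Real.Gamma)
      · apply (Real.differentiableAt_Gamma _).continuousAt
        intro m
        have : (0 : ℝ) ≤ m := m.cast_nonneg
        linarith [hx.1]
      · fun_prop
    · apply ContinuousAt.rpow continuousAt_const (by fun_prop)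
      left
      simpa using hz0
  obtain ⟨M, hM⟩ := isCompact_Icc.exists_bound_of_continuousOn hcont
  refine ⟨4 * M * Real.exp (|z.arg| * |s.im|), ?_⟩
  intro x hax hxb t ht
  have hMx := hM x ⟨hax, hxb⟩
  have hzp : 0 < ‖z‖ := norm_pos_iff.mpr hz0
  have hre : ((x : ℂ) + t * I + s).re = x + s.re := by simp
  have hG := mb_norm_Gamma_le ((x : ℂ) + t * I + s) (by rw [hre]; linarith)
  rw [hre] at hG
  have hS := mb_sin_lower x t ht
  have hS0 : 0 < Real.exp (Real.pi * |t|) / 4 := by positivity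
  have hGp : 0 < Real.Gamma (x + s.re) := Real.Gamma_pos_of_pos (by linarith)
  have hMx' : Real.Gamma (x + s.re) * ‖z‖ ^ (-x - s.re) ≤ M := (le_abs_self _).trans hMx
  have hM0 : 0 ≤ M := (norm_nonneg _).trans hMx
  have hZ : ‖z ^ (-((x : ℂ) + t * I) - s)‖ ≤
      ‖z‖ ^ (-x - s.re) * Real.exp (|z.arg| * |t| + |z.arg| * |s.im|) := by
    rw [Complex.norm_cpow_of_ne_zero hz0]
    have e1 : (-((x : ℂ) + t * I) - s).re = -x - s.re := by simp
    have e2 : (-((x : ℂ) + t * I) - s).im = -(t + s.im) := by simp; ring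
    rw [e1, e2, div_eq_mul_inv, ← Real.exp_neg]
    gcongr
    have : -(z.arg * -(t + s.im)) = z.arg * (t + s.im) := by ring
    rw [this, ← mul_add]
    refine (le_abs_self _).trans ?_
    rw [abs_mul]
    gcongr
    exact abs_add_le _ _
  unfold mbF
  rw [norm_mul, norm_div]
  calc _ ≤ Real.Gamma (x + s.re) / (Real.exp (Real.pi * |t|) / 4) *
        (‖z‖ ^ (-x - s.re) * Real.exp (|z.arg| * |t| + |z.arg| * |s.im|)) := by
        gcongr
    _ = 4 * (Real.Gamma (x + s.re) * ‖z‖ ^ (-x - s.re)) * Real.exp (|z.arg| * |s.im|) *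
        Real.exp (-(Real.pi - |z.arg|) * |t|) := by
        have : -(Real.pi - |z.arg|) * |t| = |z.arg| * |t| - Real.pi * |t| := by ring
        rw [this, Real.exp_sub, Real.exp_add]
        field_simp
    _ ≤ _ := by gcongr

lemma mb_sin_ne (u : ℂ) (k : ℤ) (h1 : (k : ℝ) < u.re) (h2 : u.re < k + 1) :
    Complex.sin (Real.pi * u) ≠ 0 := by
  intro h
  obtain ⟨m, hm⟩ := Complex.sin_eq_zero_iff.mp h
  have hpi : (Real.pi : ℂ) ≠ 0 := by exact_mod_cast Real.pi_ne_zero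
  have hu : u = m := by
    rw [mul_comm] at hm
    exact mul_right_cancel₀ hpi hm
  rw [hu] at h1 h2
  simp only [Complex.intCast_re] at h1 h2
  have h1' : k < m := by exact_mod_cast h1
  have h2' : m < k + 1 := by exact_mod_cast h2
  omega

lemma mb_num_diff (s : ℂ) (hs : 0 < s.re) (z : ℂ) (hz : z ∈ Complex.slitPlane) (u : ℂ)
    (hu : 0 < u.re) :
    DifferentiableAt ℂ (fun u => Complex.Gamma (u + s) * z ^ (-u - s)) u := by
  have hz0 : z ≠ 0 := Complex.slitPlane_ne_zero hz
  apply DifferentiableAt.mul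
  · apply DifferentiableAt.comp (f := fun u : ℂ => u + s) (g := Complex.Gamma)
    · apply Complex.differentiableAt_Gamma
      intro m h
      have := congrArg Complex.re h
      simp at this
      have hm : (0 : ℝ) ≤ m := m.cast_nonneg
      linarith
    · fun_prop
  · exact DifferentiableAt.const_cpow (by fun_prop) (Or.inl hz0)

lemma mbF_eq (s z u : ℂ) : mbF s z u =
    (Complex.Gamma (u + s) * z ^ (-u - s)) / Complex.sin (Real.pi * u) := by
  unfold mbF; ring

lemma mbF_diff (s : ℂ) (hs : 0 < s.re) (z : ℂ) (hz : z ∈ Complex.slitPlane) (u : ℂ)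
    (hu : 0 < u.re) (hsin : Complex.sin (Real.pi * u) ≠ 0) :
    DifferentiableAt ℂ (mbF s z) u := by
  have : mbF s z = fun u => (Complex.Gamma (u + s) * z ^ (-u - s)) / Complex.sin (Real.pi * u) :=
    funext (mbF_eq s z)
  rw [this]
  exact (mb_num_diff s hs z hz u hu).div (by fun_prop) hsin

lemma mbF_integrable (s : ℂ) (hs : 0 < s.re) (z : ℂ) (hz : z ∈ Complex.slitPlane) (x : ℝ) (k : ℕ)
    (h1 : (k : ℝ) < x) (h2 : x < k + 1) : Integrable (fun t : ℝ => mbF s z (x + t * I)) := by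
  have hx : 0 < x := lt_of_le_of_lt k.cast_nonneg h1
  have hδ : 0 < Real.pi - |z.arg| := sub_pos.mpr (mb_arg_lt z hz)
  obtain ⟨C, hC⟩ := mb_decay s hs z hz x x hx
  have hcont : Continuous (fun t : ℝ => mbF s z (x + t * I)) := by
    rw [continuous_iff_continuousAt]
    intro t
    apply ContinuousAt.comp (f := fun t : ℝ => (x : ℂ) + t * I) (g := mbF s z)
    · apply (mbF_diff s hs z hz _ (by simpa using hx) _).continuousAt
      exact mb_sin_ne _ k (by simpa using h1) (by simpa using h2)
    · fun_prop
  apply hcont.locallyIntegrable.integrable_of_isBigO_atBot_atTop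
    (g := fun t => Real.exp ((Real.pi - |z.arg|) * t))
    (g' := fun t => Real.exp (-(Real.pi - |z.arg|) * t))
  · apply Asymptotics.IsBigO.of_bound C
    filter_upwards [Filter.eventually_le_atBot (-1 : ℝ)] with t ht
    have habs : |t| = -t := abs_of_neg (by linarith)
    have := hC x le_rfl le_rfl t (by rw [habs]; linarith)
    rw [Real.norm_eq_abs, abs_of_pos (Real.exp_pos _)]
    convert this using 3
    rw [habs]; ring
  · exact ⟨Set.Iic 0, Filter.Iic_mem_atBot 0, integrableOn_exp_mul_Iic hδ 0⟩
  · apply Asymptotics.IsBigO.of_bound C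
    filter_upwards [Filter.eventually_ge_atTop (1 : ℝ)] with t ht
    have habs : |t| = t := abs_of_pos (by linarith)
    have := hC x le_rfl le_rfl t (by rw [habs]; linarith)
    rw [Real.norm_eq_abs, abs_of_pos (Real.exp_pos _)]
    convert this using 3
    rw [habs]
  · exact ⟨Set.Ioi 0, Filter.Ioi_mem_atTop 0, exp_neg_integrableOn_Ioi 0 hδ⟩

lemma mb_eps (s : ℂ) (hs : 0 < s.re) (z : ℂ) (hz : z ∈ Complex.slitPlane) (a b : ℝ)
    (ha : 0 < a) : ∃ ε : ℝ → ℝ, Filter.Tendsto ε Filter.atTop (nhds 0) ∧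
      ∀ x : ℝ, a ≤ x → x ≤ b → ∀ t : ℝ, 1 ≤ |t| → ‖mbF s z (x + t * I)‖ ≤ ε |t| := by
  have hδ : 0 < Real.pi - |z.arg| := sub_pos.mpr (mb_arg_lt z hz)
  obtain ⟨C, hC⟩ := mb_decay s hs z hz a b ha
  refine ⟨fun t => C * Real.exp (-(Real.pi - |z.arg|) * t), ?_, hC⟩
  have : Filter.Tendsto (fun t : ℝ => Real.exp (-(Real.pi - |z.arg|) * t)) Filter.atTop (nhds 0) :=
    Real.tendsto_exp_atBot.comp (Filter.tendsto_id.const_mul_atTop_of_neg (by linarith))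
  simpa using this.const_mul C

/-- No pole between the lines. -/
lemma mb_same_lt (s : ℂ) (hs : 0 < s.re) (z : ℂ) (hz : z ∈ Complex.slitPlane) (a b : ℝ)
    (ha : 0 < a) (hab : a < b) (hb : b < 1) :
    (∫ t : ℝ, mbF s z (b + t * I)) = ∫ t : ℝ, mbF s z (a + t * I) := by
  obtain ⟨ε, hε, hF⟩ := mb_eps s hs z hz a b ha
  have := mb_shift (mbF s z) (mbF s z) a b ((a + b) / 2) 0 (by linarith) (by linarith) ε hε
    (by
      intro u hu
      apply (mbF_diff s hs z hz u (by linarith [hu.1]) _).differentiableWithinAt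
      exact mb_sin_ne u 0 (by push_cast; linarith [hu.1]) (by push_cast; linarith [hu.2]))
    (by intro u _ _ _; simp) hF
    (mbF_integrable s hs z hz a 0 (by simpa using ha) (by push_cast; linarith))
    (mbF_integrable s hs z hz b 0 (by push_cast; linarith) (by push_cast; linarith))
  rw [mul_zero, sub_eq_zero] at this
  exact this

lemma mb_same (s : ℂ) (hs : 0 < s.re) (z : ℂ) (hz : z ∈ Complex.slitPlane) (a b : ℝ)
    (ha : 0 < a) (ha1 : a < 1) (hb0 : 0 < b) (hb : b < 1) :
    (∫ t : ℝ, mbF s z (b + t * I)) = ∫ t : ℝ, mbF s z (a + t * I) := by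
  rcases lt_trichotomy a b with h | h | h
  · exact mb_same_lt s hs z hz a b ha h hb
  · rw [h]
  · exact (mb_same_lt s hs z hz b a hb0 h ha1).symm

/-- One pole, at `n`, between the lines. -/
lemma mb_step (s : ℂ) (hs : 0 < s.re) (z : ℂ) (hz : z ∈ Complex.slitPlane) (n : ℕ) (hn : 1 ≤ n)
    (a b : ℝ) (ha : (n : ℝ) - 1 < a) (han : a < n) (hnb : (n : ℝ) < b) (hb : b < n + 1) :
    (∫ t : ℝ, mbF s z (b + t * I)) - (∫ t : ℝ, mbF s z (a + t * I)) =
      2 * ((-1 : ℂ) ^ n * Complex.Gamma (n + s) * z ^ (-(n : ℂ) - s)) := by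
  have hn' : (1 : ℝ) ≤ n := by exact_mod_cast hn
  have ha0 : 0 < a := by linarith
  have hpi : (Real.pi : ℂ) ≠ 0 := by exact_mod_cast Real.pi_ne_zero
  obtain ⟨ε, hε, hF⟩ := mb_eps s hs z hz a b ha0
  set U : Set ℂ := {u | (n : ℝ) - 1 < u.re ∧ u.re < n + 1} with hU
  have hUo : IsOpen U := by
    apply IsOpen.inter
    · exact isOpen_lt continuous_const Complex.continuous_re
    · exact isOpen_lt Complex.continuous_re continuous_const
  have hnU : U ∈ nhds (n : ℂ) := hUo.mem_nhds (by simp [hU])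
  set q : ℂ → ℂ := fun u => Complex.sin (Real.pi * u) with hq
  have hqd : Differentiable ℂ q := by rw [hq]; fun_prop
  have hqn : q n = 0 := by
    simp only [hq]
    rw [mul_comm]
    exact_mod_cast Complex.sin_nat_mul_pi n
  set D : ℂ → ℂ := dslope q n with hD
  have hDd : DifferentiableOn ℂ D U :=
    (Complex.differentiableOn_dslope hnU).mpr hqd.differentiableOn
  have hDn : D n = Real.pi * (-1) ^ n := by
    rw [hD, dslope_same]
    have h1 : HasDerivAt q (Complex.cos (Real.pi * n) * (Real.pi * 1)) n :=
      ((hasDerivAt_id (n : ℂ)).const_mul (Real.pi : ℂ)).csin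
    have h2 := Complex.cos_antiperiodic.add_nat_mul_eq (x := 0) n
    rw [zero_add, Complex.cos_zero, mul_one] at h2
    rw [h1.deriv, mul_comm (Real.pi : ℂ) n, h2]
    ring
  have hDne : ∀ u : ℂ, u ≠ n → D u = q u / (u - n) := by
    intro u hu
    rw [hD, dslope_of_ne _ hu, slope_def_field, hqn, sub_zero]
  have hsub : ∀ u ∈ U, u ≠ n → q u ≠ 0 := by
    intro u hu hun h
    obtain ⟨m, hm⟩ := Complex.sin_eq_zero_iff.mp h
    have hum : u = m := by
      rw [mul_comm] at hm
      exact mul_right_cancel₀ hpi hm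
    have h1 := hu.1
    have h2 := hu.2
    rw [hum] at h1 h2
    simp only [Complex.intCast_re] at h1 h2
    have h1' : (n : ℤ) - 1 < m := by exact_mod_cast h1
    have h2' : m < (n : ℤ) + 1 := by exact_mod_cast h2
    have h3 : m = n := by omega
    apply hun
    rw [hum, h3]
    simp
  have hD0 : ∀ u ∈ U, D u ≠ 0 := by
    intro u hu
    by_cases hun : u = n
    · rw [hun, hDn]
      exact mul_ne_zero hpi (pow_ne_zero _ (by norm_num))
    · rw [hDne u hun]
      exact div_ne_zero (hsub u hu hun) (sub_ne_zero.mpr hun)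
  set k : ℂ → ℂ := fun u => (Complex.Gamma (u + s) * z ^ (-u - s)) / D u with hk
  have hkd : DifferentiableOn ℂ k U := by
    apply DifferentiableOn.div _ hDd hD0
    intro u hu
    exact (mb_num_diff s hs z hz u (by linarith [hu.1])).differentiableWithinAt
  have hGd : DifferentiableOn ℂ (dslope k n) U :=
    (Complex.differentiableOn_dslope hnU).mpr hkd
  have hkF : ∀ u : ℂ, u ≠ n → mbF s z u = k u / (u - n) := by
    intro u hu
    have h0 : u - n ≠ 0 := sub_ne_zero.mpr hu
    simp only [hk]
    rw [mbF_eq, hDne u hu, div_div, div_mul_cancel₀ _ h0]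
  have key := mb_shift (mbF s z) (dslope k n) a b n (k n) han hnb ε hε
    (hGd.mono (by
      intro u hu
      exact ⟨by linarith [hu.1], by linarith [hu.2]⟩))
    (by
      intro u _ _ hu
      have hu' : u ≠ (n : ℂ) := by simpa using hu
      rw [dslope_of_ne _ hu', slope_def_field, hkF u hu']
      push_cast
      ring) hF
    (mbF_integrable s hs z hz a (n - 1) (by push_cast [hn]; linarith) (by push_cast [hn]; linarith))
    (mbF_integrable s hs z hz b n hnb hb)
  rw [key]
  simp only [hk]
  rw [hDn]
  have hsq : ((-1 : ℂ) ^ n) * (-1) ^ n = 1 := by rw [← mul_pow]; simp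
  have hne : ((-1 : ℂ) ^ n) ≠ 0 := pow_ne_zero _ (by norm_num)
  field_simp
  rw [pow_two, hsq]
  ring

lemma mb_all (s : ℂ) (hs : 0 < s.re) (z : ℂ) (hz : z ∈ Complex.slitPlane)
    (c c' : ℝ) (hc1 : 0 < c) (hc2 : c < 1) (hc'1 : 0 < c') (hc'2 : c' < 1) (N : ℕ) (hN : 1 ≤ N) :
    (∫ t : ℝ, mbF s z (((N - c' : ℝ) : ℂ) + t * I)) - (∫ t : ℝ, mbF s z (c + t * I)) =
      2 * ∑ r ∈ Finset.Ico 1 N, (-1 : ℂ) ^ r * Complex.Gamma (r + s) * z ^ (-(r : ℂ) - s) := by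
  induction N, hN using Nat.le_induction with
  | base =>
    rw [Finset.Ico_self, Finset.sum_empty, mul_zero, sub_eq_zero]
    exact mb_same s hs z hz c _ hc1 hc2 (by push_cast; linarith) (by push_cast; linarith)
  | succ n hn ih =>
    rw [Finset.sum_Ico_succ_top hn, mul_add, ← ih, ← mb_step s hs z hz n hn (n - c')
      ((n + 1 : ℕ) - c') (by linarith) (by linarith) (by push_cast; linarith)
      (by push_cast; linarith)]
    ring

/-- Displacement of a vertical Mellin–Barnes integration path from `Re u = c` to
`Re u = N - c'`, collecting residues at the simple poles `u = 1, …, N-1` of `1/sin(πu)`: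
for `Re s > 0`, `0 < c < 1`, `0 < c' < 1`, integer `N ≥ 1` and `z ∉ (-∞,0]`,
`(i/(4π)) ∫_ℝ Γ(c+it+s)/sin(π(c+it)) z^{-(c+it)-s} dt
  = (1/(2πi)) Σ_{r=1}^{N-1} (-1)^r Γ(r+s) z^{-r-s}
  + ((-1)^N i/(4π)) ∫_ℝ Γ(-c'+it+N+s)/sin(π(-c'+it)) z^{-(-c'+it)-N-s} dt`,
both integrals converging absolutely. -/
theorem mellinBarnes_contour_shift (s : ℂ) (hs : 0 < s.re)
    (c c' : ℝ) (hc1 : 0 < c) (hc2 : c < 1) (hc'1 : 0 < c') (hc'2 : c' < 1)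
    (N : ℕ) (hN : 1 ≤ N) (z : ℂ) (hz : z ∈ Complex.slitPlane) :
    Integrable (fun t : ℝ =>
      Complex.Gamma ((c : ℂ) + t * I + s) / Complex.sin (Real.pi * ((c : ℂ) + t * I)) *
        z ^ (-((c : ℂ) + t * I) - s)) ∧
    Integrable (fun t : ℝ =>
      Complex.Gamma (-(c' : ℂ) + t * I + N + s) / Complex.sin (Real.pi * (-(c' : ℂ) + t * I)) *
        z ^ (-(-(c' : ℂ) + t * I) - N - s)) ∧
    (I / (4 * Real.pi)) * (∫ t : ℝ,
        Complex.Gamma ((c : ℂ) + t * I + s) / Complex.sin (Real.pi * ((c : ℂ) + t * I)) *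
          z ^ (-((c : ℂ) + t * I) - s)) =
      (1 / (2 * Real.pi * I)) *
          (∑ r ∈ Finset.Ico 1 N, (-1 : ℂ) ^ r * Complex.Gamma (r + s) * z ^ (-(r : ℂ) - s)) +
        ((-1 : ℂ) ^ N * I / (4 * Real.pi)) * ∫ t : ℝ,
          Complex.Gamma (-(c' : ℂ) + t * I + N + s) /
              Complex.sin (Real.pi * (-(c' : ℂ) + t * I)) *
            z ^ (-(-(c' : ℂ) + t * I) - N - s) := by
  have hF1 : (fun t : ℝ =>
      Complex.Gamma ((c : ℂ) + t * I + s) / Complex.sin (Real.pi * ((c : ℂ) + t * I)) *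
        z ^ (-((c : ℂ) + t * I) - s)) = fun t : ℝ => mbF s z (c + t * I) := rfl
  have hF2 : (fun t : ℝ =>
      Complex.Gamma (-(c' : ℂ) + t * I + N + s) / Complex.sin (Real.pi * (-(c' : ℂ) + t * I)) *
        z ^ (-(-(c' : ℂ) + t * I) - N - s)) =
      fun t : ℝ => (-1 : ℂ) ^ N * mbF s z (((N - c' : ℝ) : ℂ) + t * I) := by
    funext t
    unfold mbF
    have e1 : ((N - c' : ℝ) : ℂ) + t * I + s = -(c' : ℂ) + t * I + N + s := by push_cast; ring
    have e2 : -(((N - c' : ℝ) : ℂ) + t * I) - s = -(-(c' : ℂ) + t * I) - N - s := by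
      push_cast; ring
    have e3 : (Real.pi : ℂ) * (((N - c' : ℝ) : ℂ) + t * I) =
        Real.pi * (-(c' : ℂ) + t * I) + N * Real.pi := by push_cast; ring
    have hsq : ((-1 : ℂ) ^ N) * (-1) ^ N = 1 := by rw [← mul_pow]; simp
    have hinv : ((-1 : ℂ) ^ N)⁻¹ = (-1) ^ N := inv_eq_of_mul_eq_one_left hsq
    rw [e1, e2, e3, Complex.sin_antiperiodic.add_nat_mul_eq, div_eq_mul_inv, div_eq_mul_inv, mul_inv, hinv]
    linear_combination (-(Complex.Gamma (-(c' : ℂ) + t * I + N + s) *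
      (Complex.sin (Real.pi * (-(c' : ℂ) + t * I)))⁻¹ * z ^ (-(-(c' : ℂ) + t * I) - N - s))) * hsq
  have hN' : (1 : ℝ) ≤ N := by exact_mod_cast hN
  have hi1 := mbF_integrable s hs z hz c 0 (by simpa using hc1) (by simpa using hc2)
  have hi2 := mbF_integrable s hs z hz (N - c') (N - 1) (by push_cast [hN]; linarith)
    (by push_cast [hN]; linarith)
  rw [hF1, hF2]
  refine ⟨hi1, hi2.const_mul _, ?_⟩
  have key := mb_all s hs z hz c c' hc1 hc2 hc'1 hc'2 N hN
  rw [integral_const_mul]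
  have hsq : ((-1 : ℂ) ^ N) * (-1) ^ N = 1 := by rw [← mul_pow]; simp
  have hpi : (Real.pi : ℂ) ≠ 0 := by exact_mod_cast Real.pi_ne_zero
  rw [sub_eq_iff_eq_add] at key
  rw [key]
  have h2 : (1 : ℂ) / (2 * Real.pi * I) = -I / (2 * Real.pi) := by
    field_simp
    simp
  rw [h2]
  generalize (∑ r ∈ Finset.Ico 1 N, (-1 : ℂ) ^ r * Complex.Gamma (r + s) * z ^ (-(r : ℂ) - s)) = S
  generalize (∫ t : ℝ, mbF s z (c + t * I)) = J
  linear_combination (-(I / (4 * Real.pi)) * (2 * S + J)) * hsq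
end
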